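/- Let R be a commutative K-algebra over an arbitrary field K, and Λ a subalgebra of D(R) properly containing R. If I is a nonzero two-sided ideal of Λ, then I ∩ R is a nonzero ideal of R which is stable under Γ = Λ ∩ Der_K(R) (i.e., γ(I ∩ R) ⊆ I ∩ R for all γ ∈ Γ), and moreover Λ(I ∩ R)Λ ∩ R = I ∩ R. -/

import Mathlib

/-- The order filtration `{D(R)_i}` on the ring of `K`-linear differential operators
on `R`. -/
def DiffOpFilt (K R : Type*) [CommSemiring K] [CommRing R] [Algebra K R] :
    ℕ → Set (Module.End K R)
  | 0 => Set.range fun r : R => (Algebra.lmul K R r : Module.End K R)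
  | i + 1 => {u | ∀ a : R,
      Algebra.lmul K R a * u - u * Algebra.lmul K R a ∈ DiffOpFilt K R i}

/-- A `K`-linear endomorphism of `R` which is a derivation. -/
def IsDerivEnd (K R : Type*) [CommSemiring K] [CommRing R] [Algebra K R]
    (u : Module.End K R) : Prop :=
  ∀ a b : R, u (a * b) = a * u b + u a * b

theorem diffop_aux (K R : Type*) [Field K] [CommRing R] [Algebra K R]
    (I : Set (Module.End K R))
    (hc : ∀ (a : R) (v : Module.End K R), v ∈ I →
      Algebra.lmul K R a * v - v * Algebra.lmul K R a ∈ I) (i : ℕ) :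
    ∀ v ∈ I, v ≠ 0 → v ∈ DiffOpFilt K R i →
      ∃ r : R, r ≠ 0 ∧ (Algebra.lmul K R r : Module.End K R) ∈ I := by
  induction i with
  | zero =>
    rintro v hv h0 ⟨r, rfl⟩
    refine ⟨r, ?_, hv⟩
    rintro rfl
    exact h0 (map_zero _)
  | succ i ih =>
    intro v hv h0 hD
    by_cases h : ∀ a : R, Algebra.lmul K R a * v - v * Algebra.lmul K R a = 0
    · have e : v = Algebra.lmul K R (v 1) := by
        ext x
        have := LinearMap.congr_fun (h x) 1
        simp [sub_eq_zero] at this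
        simp [← this, mul_comm]
      refine ⟨v 1, ?_, e ▸ hv⟩
      intro h1
      apply h0
      rw [e, h1, map_zero]
    · push Not at h
      obtain ⟨a, ha⟩ := h
      exact ih _ (hc a v hv) ha (hD a)

/-- Let `Λ` be a subalgebra of `D(R)` properly containing `R`, and `I` a nonzero
two-sided ideal of `Λ`.  Then `I ∩ R` is a nonzero ideal of `R`, stable under
`Γ = Λ ∩ Der_K(R)`, and `Λ (I ∩ R) Λ ∩ R = I ∩ R`. -/
theorem ideal_meets_base_ring (K R : Type*) [Field K] [CommRing R] [Algebra K R]
    (Λ : Subalgebra K (Module.End K R))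
    (hΛD : ∀ u ∈ Λ, ∃ i, u ∈ DiffOpFilt K R i)
    (hRΛ : ∀ r : R, (Algebra.lmul K R r : Module.End K R) ∈ Λ)
    (hne : ∃ u ∈ Λ, ∀ r : R, u ≠ (Algebra.lmul K R r : Module.End K R))
    (I : Set (Module.End K R)) (hIΛ : I ⊆ Λ)
    (hI0 : (0 : Module.End K R) ∈ I)
    (hIadd : ∀ u v, u ∈ I → v ∈ I → u + v ∈ I)
    (hImul : ∀ u v, u ∈ Λ → v ∈ I → u * v ∈ I ∧ v * u ∈ I)
    (hIne : ∃ v ∈ I, v ≠ 0) :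
    (∃ r : R, r ≠ 0 ∧ (Algebra.lmul K R r : Module.End K R) ∈ I) ∧
    (∀ δ : Module.End K R, δ ∈ Λ → IsDerivEnd K R δ →
      ∀ r : R, (Algebra.lmul K R r : Module.End K R) ∈ I →
        (Algebra.lmul K R (δ r) : Module.End K R) ∈ I) ∧
    ({r : R | (Algebra.lmul K R r : Module.End K R) ∈
        (AddSubmonoid.closure {w : Module.End K R | ∃ u ∈ Λ, ∃ v ∈ Λ, ∃ s : R,
          (Algebra.lmul K R s : Module.End K R) ∈ I ∧
          w = u * (Algebra.lmul K R s : Module.End K R) * v} :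
            AddSubmonoid (Module.End K R))} =
      {r : R | (Algebra.lmul K R r : Module.End K R) ∈ I}) := by
  have hneg : ∀ v, v ∈ I → -v ∈ I := by
    intro v hv
    have := (hImul (-1) v (neg_mem (one_mem Λ)) hv).1
    have e : -v = (-1 : Module.End K R) * v := by
      ext x
      simp
    rw [e]
    exact this
  have hsub : ∀ u v, u ∈ I → v ∈ I → u - v ∈ I := by
    intro u v hu hv
    rw [sub_eq_add_neg]
    exact hIadd _ _ hu (hneg _ hv)
  refine ⟨?_, ?_, ?_⟩
  · obtain ⟨v, hv, h0⟩ := hIne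
    obtain ⟨i, hi⟩ := hΛD v (hIΛ hv)
    exact diffop_aux K R I
      (fun a v hv => hsub _ _ (hImul _ _ (hRΛ a) hv).1 (hImul _ _ (hRΛ a) hv).2) i v hv h0 hi
  · intro δ hδ hd r hr
    have e : (Algebra.lmul K R (δ r) : Module.End K R)
        = δ * Algebra.lmul K R r - Algebra.lmul K R r * δ := by
      ext x
      simp [hd r x]
    rw [e]
    exact hsub _ _ (hImul _ _ hδ hr).1 (hImul _ _ hδ hr).2
  · ext r
    constructor
    · intro h
      let S : AddSubmonoid (Module.End K R) :=
        { carrier := I, zero_mem' := hI0, add_mem' := fun {a b} ha hb => hIadd a b ha hb }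
      refine (AddSubmonoid.closure_le (S := S)).2 ?_ h
      rintro w ⟨u, hu, v, hv, s, hs, rfl⟩
      exact (hImul _ _ hv (hImul _ _ hu hs).1).2
    · intro h
      exact AddSubmonoid.subset_closure ⟨1, one_mem Λ, 1, one_mem Λ, r, h, by simp⟩
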